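/- A compact metric space X is hereditarily indecomposable if and only if: for any map f: X → [0,1], for any simple fold φ: F → [0,1] where F is an arc, and for any ε > 0, there exists a map g: X → F such that sup_{x∈X} d(f(x), φ(g(x))) < ε. -/

import Mathlib

open Set Topology

/-- A subset of a space is *regular* if it is closed and has finitely many connected
components, each of which is non-degenerate. -/
def IsRegularSet {G : Type*} [TopologicalSpace G] (A : Set G) : Prop :=
  IsClosed A ∧ {C : Set G | ∃ x ∈ A, C = connectedComponentIn A x}.Finite ∧
    ∀ x ∈ A, (connectedComponentIn A x).Nontrivial

/-- A point of a graph is *ordinary* (neither a branch point nor an endpoint) if it has an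
open neighborhood homeomorphic to an open interval. -/
def IsOrdinaryPoint {G : Type*} [TopologicalSpace G] (x : G) : Prop :=
  ∃ U : Set G, IsOpen U ∧ x ∈ U ∧ Nonempty (U ≃ₜ Set.Ioo (0 : ℝ) 1)

/-- A topological space is a *graph* if it is a finite union of arcs which intersect
at most in endpoints. -/
def IsGraphSpace (G : Type*) [TopologicalSpace G] : Prop :=
  ∃ (n : ℕ) (f : Fin n → unitInterval → G),
    (∀ i, Continuous (f i) ∧ Function.Injective (f i)) ∧
    (⋃ i, Set.range (f i)) = Set.univ ∧
    ∀ i j, i ≠ j →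
      Set.range (f i) ∩ Set.range (f j) ⊆ ({f i 0, f i 1} : Set G) ∩ {f j 0, f j 1}

/-- A subset of a space is a *graph* if it is a finite union of arcs which intersect
at most in endpoints. -/
def IsGraphSet {E : Type*} [TopologicalSpace E] (G : Set E) : Prop :=
  ∃ (n : ℕ) (f : Fin n → unitInterval → E),
    (∀ i, Continuous (f i) ∧ Function.Injective (f i)) ∧
    G = ⋃ i, Set.range (f i) ∧
    ∀ i j, i ≠ j →
      Set.range (f i) ∩ Set.range (f j) ⊆ ({f i 0, f i 1} : Set E) ∩ {f j 0, f j 1}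

/-- `φ` restricted to `A` is a homeomorphism onto `B`. -/
def MapsHomeoOnto {F G : Type*} [TopologicalSpace F] [TopologicalSpace G]
    (φ : F → G) (A : Set F) (B : Set G) : Prop :=
  φ '' A = B ∧ Topology.IsEmbedding (A.restrict φ)

/-- A *simple fold* on `G`, with pieces `F1, F2, F3` of `F` and projection `φ : F → G`,
satisfying properties (F1)-(F5). -/
def IsSimpleFold {F G : Type*} [TopologicalSpace F] [TopologicalSpace G]
    (φ : F → G) (F1 F2 F3 : Set F) : Prop :=
  Continuous φ ∧ F1 ∪ F2 ∪ F3 = Set.univ ∧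
  -- (F1)
  ((φ '' F1).Nonempty ∧ (φ '' F2).Nonempty ∧ (φ '' F3).Nonempty) ∧
  (IsRegularSet (φ '' F1) ∧ IsRegularSet (φ '' F2) ∧ IsRegularSet (φ '' F3)) ∧
  -- (F2)
  (φ '' F1) ∪ (φ '' F3) = Set.univ ∧ (φ '' F2) = (φ '' F1) ∩ (φ '' F3) ∧
  -- (F3)
  closure ((φ '' F1) \ (φ '' F2)) ∩ closure ((φ '' F3) \ (φ '' F2)) = ∅ ∧
  -- (F4)
  (MapsHomeoOnto φ F1 (φ '' F1) ∧ MapsHomeoOnto φ F2 (φ '' F2) ∧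
    MapsHomeoOnto φ F3 (φ '' F3)) ∧
  -- (F5)
  frontier (φ '' F1) = φ '' (F1 ∩ F2) ∧ frontier (φ '' F3) = φ '' (F2 ∩ F3) ∧
  F1 ∩ F3 = ∅

/-- `S` separates `A` from `B` within `Y`: the complement `Y \ S` is the union of two
disjoint sets, relatively open in `Y \ S`, containing `A` and `B` respectively. -/
def SeparatesWithin {E : Type*} [TopologicalSpace E] (Y S A B : Set E) : Prop :=
  ∃ U V : Set E,
    U ∪ V = Y \ S ∧ U ∩ V = ∅ ∧ A ⊆ U ∧ B ⊆ V ∧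
    (∃ U', IsOpen U' ∧ U = (Y \ S) ∩ U') ∧ (∃ V', IsOpen V' ∧ V = (Y \ S) ∩ V')

/-- `A` has *consistent complement relative to* `B`: for each component `C` of the
complement of `A`, either `∂C ⊆ B` or `∂C ∩ B = ∅`. -/
def ConsistentComplement {G : Type*} [TopologicalSpace G] (A B : Set G) : Prop :=
  ∀ x ∉ A, frontier (connectedComponentIn Aᶜ x) ⊆ B ∨
    frontier (connectedComponentIn Aᶜ x) ∩ B = ∅

/-- The *`A` side of `B`*, `σ_B(A)`: the closure of the union of all components of
`G \ B` meeting `A`. -/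
def sideOf {G : Type*} [TopologicalSpace G] (B A : Set G) : Set G :=
  closure (⋃ x ∈ {x : G | x ∉ B ∧ (connectedComponentIn Bᶜ x ∩ A).Nonempty},
    connectedComponentIn Bᶜ x)

/-- A subset of `G × [0,1]` is *straight* if it is closed, the projection is injective on
it, and its projection is regular. -/
def IsStraight {G : Type*} [TopologicalSpace G] (S : Set (G × unitInterval)) : Prop :=
  IsClosed S ∧ Set.InjOn Prod.fst S ∧ IsRegularSet (Prod.fst '' S)

/-- The *end set* of a straight set. -/
def endSet {G : Type*} [TopologicalSpace G] (S : Set (G × unitInterval)) :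
    Set (G × unitInterval) :=
  S ∩ Prod.fst ⁻¹' (frontier (Prod.fst '' S))

/-- A *stairwell structure* of height `k` for `S ⊆ G × [0,1]`, given by the pieces
`Sp 1, …, Sp k` with end set decompositions `E(Sp i) = α i ∪ β i`. -/
def IsStairwell {G : Type*} [TopologicalSpace G]
    (Sp α β : ℕ → Set (G × unitInterval)) (k : ℕ) (S : Set (G × unitInterval)) : Prop :=
  1 ≤ k ∧
  -- (S1)
  (∀ i ∈ Set.Icc 1 k, (Sp i).Nonempty ∧ IsStraight (Sp i)) ∧
  S = ⋃ i ∈ Set.Icc 1 k, Sp i ∧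
  -- (S2)
  (∀ i ∈ Set.Icc 1 k, endSet (Sp i) = α i ∪ β i ∧ α i ∩ β i = ∅ ∧
    (α i).Finite ∧ (β i).Finite) ∧
  α 1 = ∅ ∧ β k = ∅ ∧ (∀ i, 1 ≤ i → i < k → β i = α (i + 1)) ∧
  -- (S3)
  (∀ i, 1 ≤ i → i < k → ∃ V : Set G, IsOpen V ∧ Prod.fst '' β i ⊆ V ∧
    Prod.fst '' Sp i ∩ V = Prod.fst '' Sp (i + 1) ∩ V) ∧
  -- (S4)
  (∀ i ∈ Set.Icc 1 k, ConsistentComplement (Prod.fst '' Sp i) (Prod.fst '' α i) ∧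
    ConsistentComplement (Prod.fst '' Sp i) (Prod.fst '' β i)) ∧
  -- (S5)
  (∀ i ∈ Set.Icc 2 k, ∀ p ∈ α i, IsOrdinaryPoint p.1) ∧
  (∀ i j, 2 ≤ i → i < j → j ≤ k → Prod.fst '' α i ∩ Prod.fst '' α j = ∅)

/-- A *broken stairwell structure* of height `k` with a pit at level `i0`. -/
def IsBrokenStairwell {G : Type*} [TopologicalSpace G]
    (Sp α β : ℕ → Set (G × unitInterval)) (γ P1 P2 : Set (G × unitInterval))
    (k i0 : ℕ) (S : Set (G × unitInterval)) : Prop :=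
  1 ≤ k ∧ 1 ≤ i0 ∧ i0 ≤ k ∧
  -- (S1')
  (∀ i ∈ Set.Icc 1 k, (Sp i).Nonempty ∧ IsStraight (Sp i)) ∧
  P1.Nonempty ∧ IsStraight P1 ∧ P2.Nonempty ∧ IsStraight P2 ∧
  S = (⋃ i ∈ Set.Icc 1 k, Sp i) ∪ P1 ∪ P2 ∧
  -- (S2')
  (∀ i ∈ Set.Icc 1 k, i ≠ i0 → endSet (Sp i) = α i ∪ β i) ∧
  endSet (Sp i0) = α i0 ∪ β i0 ∪ γ ∧
  (∀ i ∈ Set.Icc 1 k, α i ∩ β i = ∅ ∧ (α i).Finite ∧ (β i).Finite) ∧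
  γ.Finite ∧ α i0 ∩ γ = ∅ ∧ β i0 ∩ γ = ∅ ∧
  α 1 = ∅ ∧ β k = ∅ ∧ (∀ i, 1 ≤ i → i < k → β i = α (i + 1)) ∧
  endSet P2 = endSet P1 ∪ γ ∧ endSet P1 ∩ γ = ∅ ∧
  -- (S3')
  (∀ i, 1 ≤ i → i < k → ∃ V : Set G, IsOpen V ∧ Prod.fst '' β i ⊆ V ∧
    Prod.fst '' Sp i ∩ V = Prod.fst '' Sp (i + 1) ∩ V) ∧
  (∃ V : Set G, IsOpen V ∧ Prod.fst '' endSet P1 ⊆ V ∧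
    Prod.fst '' P1 ∩ V = Prod.fst '' P2 ∩ V) ∧
  (∃ W : Set G, IsOpen W ∧ Prod.fst '' γ ⊆ W ∧
    Prod.fst '' P2 ∩ W = Prod.fst '' Sp i0 ∩ W) ∧
  -- (S4')
  (∀ i ∈ Set.Icc 1 k, ConsistentComplement (Prod.fst '' Sp i) (Prod.fst '' α i) ∧
    ConsistentComplement (Prod.fst '' Sp i) (Prod.fst '' β i)) ∧
  ConsistentComplement (Prod.fst '' Sp i0) (Prod.fst '' γ) ∧
  ConsistentComplement (Prod.fst '' P2) (Prod.fst '' endSet P1) ∧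
  ConsistentComplement (Prod.fst '' P2) (Prod.fst '' γ) ∧
  -- (S5')
  (∀ i ∈ Set.Icc 2 k, ∀ p ∈ α i, IsOrdinaryPoint p.1) ∧
  (∀ p ∈ endSet P1, IsOrdinaryPoint p.1) ∧ (∀ p ∈ γ, IsOrdinaryPoint p.1) ∧
  (∀ i j, 2 ≤ i → i < j → j ≤ k → Prod.fst '' α i ∩ Prod.fst '' α j = ∅) ∧
  (∀ i ∈ Set.Icc 2 k, Prod.fst '' α i ∩ Prod.fst '' endSet P1 = ∅ ∧
    Prod.fst '' α i ∩ Prod.fst '' γ = ∅) ∧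
  Prod.fst '' endSet P1 ∩ Prod.fst '' γ = ∅ ∧
  -- (S6')
  Prod.fst '' α i0 ∩ Prod.fst '' (P1 ∪ P2) = ∅

/-- A compactum is *hereditarily indecomposable* if every non-degenerate subcontinuum is
indecomposable, i.e. is not the union of two proper subcontinua. -/
def HereditarilyIndecomposable (X : Type*) [TopologicalSpace X] : Prop :=
  ∀ K : Set X, IsCompact K → IsConnected K → K.Nontrivial →
    ¬ ∃ A B : Set X, IsCompact A ∧ IsConnected A ∧ IsCompact B ∧ IsConnected B ∧
      A ∪ B = K ∧ A ≠ K ∧ B ≠ K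

/-- A continuum is *arc-like* if for every `ε > 0` it admits an `ε`-map onto `[0,1]`. -/
def ArcLike (X : Type*) [MetricSpace X] : Prop :=
  ∀ ε > (0 : ℝ), ∃ f : X → unitInterval, Continuous f ∧ Function.Surjective f ∧
    ∀ y, Metric.diam (f ⁻¹' {y}) < ε

/-- A continuum has *span zero* if every subcontinuum `Z ⊆ X × X` with
`π₁(Z) ⊆ π₂(Z)` meets the diagonal. -/
def SpanZero (X : Type*) [TopologicalSpace X] : Prop :=
  ∀ Z : Set (X × X), IsCompact Z → IsConnected Z →
    Prod.fst '' Z ⊆ Prod.snd '' Z → ∃ x, (x, x) ∈ Z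

/-- A closed set in a compact Hausdorff space can be separated by a clopen set from the complement
of any open set containing the components of all its points. -/
theorem exists_isClopen_of_connectedComponent_subset {Y : Type*} [TopologicalSpace Y]
    [CompactSpace Y] [T2Space Y] {A O : Set Y} (hA : IsClosed A) (hO : IsOpen O)
    (h : ∀ a ∈ A, connectedComponent a ⊆ O) : ∃ W, IsClopen W ∧ A ⊆ W ∧ W ⊆ O := by
  have hc : Continuous (ConnectedComponents.mk : Y → _) := ConnectedComponents.continuous_coe
  have h1 : IsClosed (ConnectedComponents.mk '' A) := (hA.isCompact.image hc).isClosed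
  have h2 : IsClosed (ConnectedComponents.mk '' Oᶜ) :=
    (hO.isClosed_compl.isCompact.image hc).isClosed
  obtain ⟨C, hC, hAC, hCO⟩ := exists_clopen_of_closed_subset_open h1 h2.isOpen_compl (by
    rintro _ ⟨a, ha, rfl⟩ ⟨b, hb, hab⟩
    exact hb (h a ha (ConnectedComponents.coe_eq_coe'.1 hab)))
  refine ⟨ConnectedComponents.mk ⁻¹' C, hC.preimage hc, fun a ha => hAC ⟨a, ha, rfl⟩, ?_⟩
  intro x hx
  by_contra hxO
  exact hCO hx ⟨x, hxO, rfl⟩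

/-- The union of the components meeting a closed set is closed in a compact Hausdorff space. -/
theorem isClosed_biUnion_connectedComponent {Y : Type*} [TopologicalSpace Y]
    [CompactSpace Y] [T2Space Y] {A : Set Y} (hA : IsClosed A) :
    IsClosed (⋃ a ∈ A, connectedComponent a) := by
  have hc : Continuous (ConnectedComponents.mk : Y → _) := ConnectedComponents.continuous_coe
  convert (hA.isCompact.image hc).isClosed.preimage hc using 1
  ext x
  simp only [mem_iUnion, mem_preimage, mem_image, exists_prop]
  exact exists_congr fun a => and_congr_right fun _ =>
    ⟨fun h => (ConnectedComponents.coe_eq_coe'.2 h).symm,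
      fun h => ConnectedComponents.coe_eq_coe'.1 h.symm⟩

/-- A relatively clopen subset of the complement of an open set `V` meets the closure of its own
complement only in the closure of `V`. -/
theorem inter_closure_compl_subset_of_isClopen {X : Type*} [TopologicalSpace X] {V : Set X}
    {W : Set ↥Vᶜ} (hW : IsClopen W) :
    ((↑) '' W : Set X) ∩ closure ((↑) '' W : Set X)ᶜ ⊆ closure V := by
  obtain ⟨O, hO, rfl⟩ := isOpen_induced_iff.1 hW.isOpen
  rintro _ ⟨⟨x, hx, rfl⟩, hxc⟩
  rw [mem_closure_iff] at hxc ⊢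
  intro N hN hxN
  obtain ⟨y, ⟨hyN, hyO⟩, hy⟩ := hxc (N ∩ O) (hN.inter hO) ⟨hxN, hx⟩
  refine ⟨y, hyN, ?_⟩
  by_contra hyV
  exact hy ⟨⟨y, hyV⟩, hyO, rfl⟩

/-- Disjoint closed subsets of a hereditarily indecomposable compactum have the three-piece
covers of Krasinkiewicz and Minc. -/
theorem HereditarilyIndecomposable.exists_cover {X : Type*} [TopologicalSpace X] [CompactSpace X]
    [T2Space X] (hX : HereditarilyIndecomposable X) {A B U V : Set X} (hA : IsClosed A)
    (hB : IsClosed B) (hAB : Disjoint A B) (hU : IsOpen U) (hV : IsOpen V) (hAU : A ⊆ U)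
    (hBV : B ⊆ V) :
    ∃ X₁ X₂ X₃ : Set X, IsClosed X₁ ∧ IsClosed X₂ ∧ IsClosed X₃ ∧ X₁ ∪ X₂ ∪ X₃ = univ ∧
      A ⊆ X₁ ∧ B ⊆ X₃ ∧ X₁ ∩ X₂ ⊆ V ∧ X₂ ∩ X₃ ⊆ U ∧ X₁ ∩ X₃ = ∅ := by
  obtain ⟨U₀, hU₀, hAU₀, hUU₀⟩ := normal_exists_closure_subset hA (hU.inter hB.isOpen_compl)
    (fun x hx => ⟨hAU hx, hAB.notMem_of_mem_left hx⟩)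
  obtain ⟨V₀, hV₀, hBV₀, hVV₀⟩ := normal_exists_closure_subset hB (hV.inter hA.isOpen_compl)
    (fun x hx => ⟨hBV hx, hAB.notMem_of_mem_right hx⟩)
  have hAV₀ : ∀ x ∈ A, x ∈ V₀ᶜ := fun x hx h => (hVV₀ (subset_closure h)).2 hx
  have hBU₀ : ∀ x ∈ B, x ∈ U₀ᶜ := fun x hx h => (hUU₀ (subset_closure h)).2 hx
  have : CompactSpace ↥V₀ᶜ := isCompact_iff_compactSpace.1 hV₀.isClosed_compl.isCompact
  have : CompactSpace ↥U₀ᶜ := isCompact_iff_compactSpace.1 hU₀.isClosed_compl.isCompact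
  let A' : Set ↥V₀ᶜ := (↑) ⁻¹' A
  let B' : Set ↥U₀ᶜ := (↑) ⁻¹' B
  have hA' : IsClosed A' := hA.preimage continuous_subtype_val
  have hB' : IsClosed B' := hB.preimage continuous_subtype_val
  let P : Set X := (↑) '' (⋃ a ∈ A', connectedComponent a)
  let Q : Set X := (↑) '' (⋃ b ∈ B', connectedComponent b)
  have hP : IsClosed P := ((isClosed_biUnion_connectedComponent hA').isCompact.image
    continuous_subtype_val).isClosed
  have hQ : IsClosed Q := ((isClosed_biUnion_connectedComponent hB').isCompact.image
    continuous_subtype_val).isClosed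
  have hPQ : Disjoint P Q := by
    rw [Set.disjoint_left]
    rintro _ ⟨x, hx, rfl⟩ ⟨y, hy, hyx⟩
    simp only [mem_iUnion, exists_prop] at hx hy
    obtain ⟨a, ha, hxa⟩ := hx
    obtain ⟨b, hb, hyb⟩ := hy
    set C : Set X := (↑) '' connectedComponent a
    set D : Set X := (↑) '' connectedComponent b
    have hCc : IsCompact C := isClosed_connectedComponent.isCompact.image continuous_subtype_val
    have hDc : IsCompact D := isClosed_connectedComponent.isCompact.image continuous_subtype_val
    have hCn : IsConnected C := isConnected_connectedComponent.image _
      continuous_subtype_val.continuousOn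
    have hDn : IsConnected D := isConnected_connectedComponent.image _
      continuous_subtype_val.continuousOn
    have hxC : (x : X) ∈ C := ⟨x, hxa, rfl⟩
    have hxD : (x : X) ∈ D := ⟨y, hyb, hyx⟩
    have haC : (a : X) ∈ C := ⟨a, mem_connectedComponent, rfl⟩
    have hbD : (b : X) ∈ D := ⟨b, mem_connectedComponent, rfl⟩
    have haD : (a : X) ∉ D := by
      rintro ⟨z, -, hz⟩
      exact z.2 (hz ▸ hAU₀ ha)
    have hbC : (b : X) ∉ C := by
      rintro ⟨z, -, hz⟩
      exact z.2 (hz ▸ hBV₀ hb)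
    refine hX (C ∪ D) (hCc.union hDc) (hCn.union ⟨x, hxC, hxD⟩ hDn)
      ⟨a, Or.inl haC, b, Or.inr hbD, fun h => haD (h ▸ hbD)⟩
      ⟨C, D, hCc, hCn, hDc, hDn, rfl, fun h => hbC (h ▸ Or.inr hbD),
        fun h => haD (h ▸ Or.inl haC)⟩
  obtain ⟨O₁, O₂, hO₁, hO₂, hPO, hQO, hOO⟩ := normal_separation hP hQ hPQ
  obtain ⟨W₁, hW₁, hAW, hWO₁⟩ := exists_isClopen_of_connectedComponent_subset hA'
    (hO₁.preimage continuous_subtype_val)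
    (fun a ha x hx => hPO ⟨x, mem_biUnion ha hx, rfl⟩)
  obtain ⟨W₂, hW₂, hBW, hWO₂⟩ := exists_isClopen_of_connectedComponent_subset hB'
    (hO₂.preimage continuous_subtype_val)
    (fun a ha x hx => hQO ⟨x, mem_biUnion ha hx, rfl⟩)
  let X₁ : Set X := (↑) '' W₁
  let X₃ : Set X := (↑) '' W₂
  refine ⟨X₁, closure (X₁ ∪ X₃)ᶜ, X₃,
    (hW₁.isClosed.isCompact.image continuous_subtype_val).isClosed, isClosed_closure,
    (hW₂.isClosed.isCompact.image continuous_subtype_val).isClosed, ?_,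
    fun x hx => ⟨⟨x, hAV₀ x hx⟩, hAW hx, rfl⟩, fun x hx => ⟨⟨x, hBU₀ x hx⟩, hBW hx, rfl⟩,
    ?_, ?_, ?_⟩
  · refine eq_univ_of_forall fun x => ?_
    by_cases h : x ∈ X₁ ∪ X₃
    · exact h.elim (fun h => Or.inl (Or.inl h)) Or.inr
    · exact Or.inl (Or.inr (subset_closure h))
  · exact fun x hx => (hVV₀ (inter_closure_compl_subset_of_isClopen hW₁
      ⟨hx.1, closure_mono (compl_subset_compl.2 subset_union_left) hx.2⟩)).1
  · exact fun x hx => (hUU₀ (inter_closure_compl_subset_of_isClopen hW₂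
      ⟨hx.2, closure_mono (compl_subset_compl.2 subset_union_right) hx.1⟩)).1
  · refine eq_empty_of_forall_notMem ?_
    rintro _ ⟨⟨x, hx, rfl⟩, ⟨y, hy, hyx⟩⟩
    exact Set.disjoint_left.1 hOO (hWO₁ hx) (hyx ▸ hWO₂ hy)

/-- A regular subset of the unit interval has finite frontier. -/
theorem IsRegularSet.finite_frontier {A : Set unitInterval} (hA : IsRegularSet A) :
    (frontier A).Finite := by
  obtain ⟨hcl, hfin, -⟩ := hA
  set 𝒞 := {C : Set unitInterval | ∃ x ∈ A, C = connectedComponentIn A x}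
  refine (hfin.biUnion (t := fun C => {sInf C, sSup C}) fun C _ => by simp).subset ?_
  intro x hx
  have hxA : x ∈ A := hcl.frontier_subset hx
  refine mem_biUnion (x := connectedComponentIn A x) ⟨x, hxA, rfl⟩ ?_
  have hxC := mem_connectedComponentIn hxA
  have hC : IsConnected (connectedComponentIn A x) := isConnected_connectedComponentIn_iff.2 hxA
  have hCcl : IsClosed (connectedComponentIn A x) := by
    refine isClosed_of_closure_subset ?_
    exact hC.isPreconnected.closure.subset_connectedComponentIn (subset_closure hxC)
      (closure_minimal (connectedComponentIn_subset A x) hcl)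
  have hIcc := eq_Icc_of_connected_compact hC hCcl.isCompact
  have h1 : sInf (connectedComponentIn A x) ≤ x := sInf_le hxC
  have h2 : x ≤ sSup (connectedComponentIn A x) := le_sSup hxC
  by_contra hne
  simp only [mem_insert_iff, mem_singleton_iff, not_or] at hne
  refine hx.2 (mem_interior.2 ⟨Ioo (sInf (connectedComponentIn A x))
    (sSup (connectedComponentIn A x)), ?_, isOpen_Ioo,
    lt_of_le_of_ne h1 (Ne.symm hne.1), lt_of_le_of_ne h2 hne.2⟩)
  refine Ioo_subset_Icc_self.trans ?_
  rw [← hIcc]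
  exact connectedComponentIn_subset A x

/-- A monotone self-map of the unit interval, close to the identity, that collapses a neighborhood
of a given point to that point and is the identity elsewhere. -/
theorem exists_monotone_flat_at (a : unitInterval) {η : ℝ} (hη : 0 < η) :
    ∃ k : unitInterval → unitInterval, Continuous k ∧ Monotone k ∧
      (∀ x, dist (k x) x ≤ η) ∧ (∀ x, dist x a ≤ η → k x = a) ∧
      ∀ x, 2 * η ≤ dist x a → k x = x := by
  let r : ℝ → ℝ := fun x => min (max x a) (max a (2 * x - a - 2 * η)) +
    max (min x a) (min a (2 * x - a + 2 * η)) - a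
  have ha := a.2
  have hr0 : ∀ x : ℝ, x ≤ a → r x = max x (min a (2 * x - a + 2 * η)) := by
    intro x hx
    have : 2 * x - a - 2 * η ≤ a := by linarith
    simp only [r, max_eq_right hx, min_eq_left hx, max_eq_left this, min_self]
    ring
  have hr1 : ∀ x : ℝ, a ≤ x → r x = min x (max a (2 * x - a - 2 * η)) := by
    intro x hx
    have : a ≤ 2 * x - a + 2 * η := by linarith
    simp only [r, max_eq_left hx, min_eq_right hx, min_eq_left this, max_self]
    ring
  have hrI : ∀ x : unitInterval, r x ∈ Icc (0 : ℝ) 1 := by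
    intro x
    have hx := x.2
    rcases le_total (x : ℝ) a with h | h
    · rw [hr0 _ h]
      exact ⟨le_max_of_le_left hx.1, max_le hx.2 ((min_le_left _ _).trans ha.2)⟩
    · rw [hr1 _ h]
      exact ⟨le_min hx.1 (le_max_of_le_left ha.1), (min_le_left _ _).trans hx.2⟩
  refine ⟨fun x => ⟨r x, hrI x⟩, ?_, ?_, ?_, ?_, ?_⟩
  · exact Continuous.subtype_mk (by simp only [r]; fun_prop) _
  · intro x y hxy
    have hxy' : (x : ℝ) ≤ y := hxy
    change r x ≤ r y
    simp only [r]
    gcongr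
  · intro x
    rw [Subtype.dist_eq, Real.dist_eq, abs_le]
    change -η ≤ r x - x ∧ r x - x ≤ η
    rcases le_total (x : ℝ) a with h | h
    · rw [hr0 _ h]
      rcases max_cases (x : ℝ) (min a (2 * x - a + 2 * η)) with ⟨h1, h2⟩ | ⟨h1, h2⟩ <;>
      rcases min_cases (a : ℝ) (2 * x - a + 2 * η) with ⟨h3, h4⟩ | ⟨h3, h4⟩ <;> constructor <;> linarith
    · rw [hr1 _ h]
      rcases min_cases (x : ℝ) (max a (2 * x - a - 2 * η)) with ⟨h1, h2⟩ | ⟨h1, h2⟩ <;>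
      rcases max_cases (a : ℝ) (2 * x - a - 2 * η) with ⟨h3, h4⟩ | ⟨h3, h4⟩ <;> constructor <;> linarith
  · intro x hx
    rw [Subtype.dist_eq, Real.dist_eq, abs_le] at hx
    apply Subtype.ext
    change r x = a
    rcases le_total (x : ℝ) a with h | h
    · rw [hr0 _ h, min_eq_left (by linarith), max_eq_right h]
    · rw [hr1 _ h, max_eq_left (by linarith), min_eq_right h]
  · intro x hx
    rw [Subtype.dist_eq, Real.dist_eq, le_abs] at hx
    apply Subtype.ext
    change r x = x
    rcases le_total (x : ℝ) a with h | h
    · have h1 : (x : ℝ) ≤ a - 2 * η := by rcases hx with hx | hx <;> linarith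
      rw [hr0 _ h, min_eq_right (by linarith), max_eq_left (by linarith)]
    · have h1 : a + 2 * η ≤ (x : ℝ) := by rcases hx with hx | hx <;> linarith
      rw [hr1 _ h, max_eq_right (by linarith), min_eq_left (by linarith)]

/-- A monotone self-map of the unit interval, close to the identity, that is locally constant
with its fixed value near each point of a given finite set. -/
theorem Set.Finite.exists_monotone_flat {S : Set unitInterval} (hS : S.Finite) :
    ∀ ε > (0 : ℝ), ∃ h : unitInterval → unitInterval, Continuous h ∧ Monotone h ∧
      (∀ x, dist (h x) x < ε) ∧ ∀ s ∈ S, ∀ᶠ x in 𝓝 s, h x = s := by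
  induction S, hS using Set.Finite.induction_on with
  | empty => exact fun ε hε => ⟨id, continuous_id, monotone_id, by simpa using hε, by simp⟩
  | @insert a S haS hS ih =>
    intro ε hε
    obtain ⟨η, hη, hηε, hηS⟩ : ∃ η > (0 : ℝ), η < ε / 2 ∧ ∀ s ∈ S, 2 * η < dist s a := by
      obtain ⟨δ, hδ, hball⟩ := Metric.isOpen_iff.1 hS.isClosed.isOpen_compl a haS
      refine ⟨min (ε / 4) (δ / 4), by positivity, ?_, fun s hs => ?_⟩
      · linarith [min_le_left (ε / 4) (δ / 4)]
      · have : δ ≤ dist s a := by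
          by_contra hlt
          exact hball (Metric.mem_ball.2 (not_le.1 hlt)) hs
        linarith [min_le_right (ε / 4) (δ / 4)]
    obtain ⟨k, hkc, hkm, hkd, hka, hkid⟩ := exists_monotone_flat_at a hη
    obtain ⟨h, hhc, hhm, hhd, hhS⟩ := ih (η / 2) (by positivity)
    refine ⟨k ∘ h, hkc.comp hhc, hkm.comp hhm, fun x => ?_, ?_⟩
    · have h1 := hkd (h x)
      have h2 := hhd x
      have h3 := dist_triangle (k (h x)) (h x) x
      simp only [Function.comp_apply]
      linarith
    · rintro s (rfl | hs)
      · filter_upwards [Metric.ball_mem_nhds s (half_pos hη)] with x hx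
        refine hka _ ?_
        have h2 := hhd x
        have h3 := dist_triangle (h x) x s
        rw [Metric.mem_ball] at hx
        linarith
      · filter_upwards [hhS s hs] with x hx
        simp only [Function.comp_apply, hx]
        exact hkid s (hηS s hs).le

/-- A monotone self-map of the unit interval fixing the frontier of a closed set maps that set to
itself. -/
theorem Monotone.mapsTo_of_fixes_frontier {h : unitInterval → unitInterval} (hm : Monotone h)
    {G : Set unitInterval} (hG : IsClosed G) (hfix : ∀ s ∈ frontier G, h s = s) :
    MapsTo h G G := by
  intro y hy
  by_contra hhy
  obtain ⟨z, hz, hzG, hzc⟩ := isPreconnected_closed_iff.1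
    (ordConnected_uIcc (a := y) (b := h y)).isPreconnected G (closure Gᶜ) hG isClosed_closure
    (fun x _ => (em (x ∈ G)).imp id fun h => subset_closure h) ⟨y, left_mem_uIcc, hy⟩
    ⟨h y, right_mem_uIcc, subset_closure hhy⟩
  have hzf : h z = z := hfix z (by
    rw [frontier_eq_closure_inter_closure]
    exact ⟨subset_closure hzG, hzc⟩)
  rcases mem_uIcc.1 hz with ⟨h1, h2⟩ | ⟨h1, h2⟩
  · exact hhy ((le_antisymm (hzf ▸ hm h1) h2) ▸ hzG)
  · exact hhy ((le_antisymm h1 (hzf ▸ hm h2)) ▸ hzG)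

/-- A map into a compact space with closed graph is continuous. -/
theorem continuous_of_isClosed_setOf_eq {X Y : Type*} [TopologicalSpace X] [TopologicalSpace Y]
    [CompactSpace Y] {g : X → Y} (hg : IsClosed {p : X × Y | p.2 = g p.1}) : Continuous g := by
  refine continuous_iff_isClosed.2 fun C hC => ?_
  convert isClosedMap_fst_of_compactSpace _ (hg.inter (hC.preimage continuous_snd)) using 1
  ext x
  simp

/-- Maps to the unit interval from a hereditarily indecomposable compactum lift approximately
through simple folds. -/
theorem HereditarilyIndecomposable.exists_lift {X : Type*} [TopologicalSpace X] [CompactSpace X]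
    [T2Space X] (hX : HereditarilyIndecomposable X) {f : X → unitInterval} (hf : Continuous f)
    {F : Type*} [TopologicalSpace F] [CompactSpace F] [T2Space F] {φ : F → unitInterval}
    {F1 F2 F3 : Set F} (hφ : IsSimpleFold φ F1 F2 F3) {ε : ℝ} (hε : 0 < ε) :
    ∃ g : X → F, Continuous g ∧ ∀ x, dist (f x) (φ (g x)) < ε := by
  obtain ⟨hφc, -, -, ⟨hG1, hG2, hG3⟩, hG13, hG2eq, hdisj, ⟨hM1, hM2, hM3⟩, hfr1, hfr3, -⟩ := hφ
  have hinj : ∀ {E : Set F}, MapsHomeoOnto φ E (φ '' E) → InjOn φ E := fun h =>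
    injOn_iff_injective.2 h.2.injective
  have hclosed : ∀ {E : Set F}, IsClosed (φ '' E) → MapsHomeoOnto φ E (φ '' E) → IsClosed E := by
    intro E hE h
    have hce : IsClosedEmbedding (E.domRestrict φ) := ⟨h.2, by rwa [range_domRestrict]⟩
    have := hce.compactSpace
    exact (isCompact_iff_compactSpace.2 this).isClosed
  have hF1 := hclosed hG1.1 hM1
  have hF2 := hclosed hG2.1 hM2
  have hF3 := hclosed hG3.1 hM3
  have hi1 := hinj hM1
  have hi2 := hinj hM2
  have hi3 := hinj hM3
  obtain ⟨h, hhc, hhm, hhd, hhS⟩ :=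
    (hG1.finite_frontier.union hG3.finite_frontier).exists_monotone_flat ε hε
  have hmap1 : MapsTo h (φ '' F1) (φ '' F1) := hhm.mapsTo_of_fixes_frontier hG1.1
    fun s hs => (hhS s (Or.inl hs)).self_of_nhds
  have hmap3 : MapsTo h (φ '' F3) (φ '' F3) := hhm.mapsTo_of_fixes_frontier hG3.1
    fun s hs => (hhS s (Or.inr hs)).self_of_nhds
  set K1 := closure (φ '' F1 \ φ '' F2)
  set K3 := closure (φ '' F3 \ φ '' F2)
  set N1 := interior (h ⁻¹' frontier (φ '' F1))
  set N3 := interior (h ⁻¹' frontier (φ '' F3))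
  have hN1s : frontier (φ '' F1) ⊆ N1 := fun s hs => mem_interior_iff_mem_nhds.2 <| by
    filter_upwards [hhS s (Or.inl hs)] with x hx
    rw [mem_preimage, hx]
    exact hs
  have hN3s : frontier (φ '' F3) ⊆ N3 := fun s hs => mem_interior_iff_mem_nhds.2 <| by
    filter_upwards [hhS s (Or.inr hs)] with x hx
    rw [mem_preimage, hx]
    exact hs
  have hfrc : ∀ {G H : Set unitInterval}, H ⊆ Gᶜ → closure H ⊆ Gᶜ ∪ frontier G := by
    intro G H hHG x hx
    by_cases hxG : x ∈ G
    · right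
      rw [frontier_eq_closure_inter_closure]
      exact ⟨subset_closure hxG, closure_mono hHG hx⟩
    · exact Or.inl hxG
  have hK13 : Disjoint K1 K3 := disjoint_iff_inter_eq_empty.2 hdisj
  obtain ⟨X₁, X₂, X₃, hX₁, hX₂, hX₃, hcov, hAX, hBX, h12, h23, h13⟩ :=
    hX.exists_cover (A := f ⁻¹' K1) (B := f ⁻¹' K3)
      (U := f ⁻¹' (K3ᶜ ∩ ((φ '' F3)ᶜ ∪ N3))) (V := f ⁻¹' (K1ᶜ ∩ ((φ '' F1)ᶜ ∪ N1)))
      (isClosed_closure.preimage hf) (isClosed_closure.preimage hf) (hK13.preimage f)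
      ((isClosed_closure.isOpen_compl.inter (hG3.1.isOpen_compl.union isOpen_interior)).preimage hf)
      ((isClosed_closure.isOpen_compl.inter (hG1.1.isOpen_compl.union isOpen_interior)).preimage hf)
      (fun x hx => ⟨hK13.notMem_of_mem_left hx, (hfrc (fun y hy hy3 => hy.2
        (hG2eq ▸ ⟨hy.1, hy3⟩)) hx).imp id fun h => hN3s h⟩)
      (fun x hx => ⟨hK13.notMem_of_mem_right hx, (hfrc (fun y hy hy1 => hy.2
        (hG2eq ▸ ⟨hy1, hy.1⟩)) hx).imp id fun h => hN1s h⟩)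
  have hor : ∀ y, y ∈ φ '' F1 ∨ y ∈ φ '' F3 := fun y => (Set.ext_iff.1 hG13 y).2 (mem_univ y)
  have hf1 : ∀ x, f x ∉ K3 → f x ∈ φ '' F1 := fun x hx => by
    by_contra h1
    exact hx (subset_closure ⟨(hor _).resolve_left h1, fun h2 => h1 (hG2eq ▸ h2).1⟩)
  have hf3 : ∀ x, f x ∉ K1 → f x ∈ φ '' F3 := fun x hx => by
    by_contra h1
    exact hx (subset_closure ⟨(hor _).resolve_right h1, fun h2 => h1 (hG2eq ▸ h2).2⟩)
  have hX₁f : ∀ x ∈ X₁, f x ∈ φ '' F1 := fun x hx => hf1 x fun h =>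
    eq_empty_iff_forall_notMem.1 h13 x ⟨hx, hBX h⟩
  have hX₃f : ∀ x ∈ X₃, f x ∈ φ '' F3 := fun x hx => hf3 x fun h =>
    eq_empty_iff_forall_notMem.1 h13 x ⟨hAX h, hx⟩
  have hX₂f : ∀ x ∈ X₂, f x ∈ φ '' F1 ∧ f x ∈ φ '' F3 := fun x hx =>
    ⟨hf1 x fun h => (h23 ⟨hx, hBX h⟩).1 h, hf3 x fun h => (h12 ⟨hAX h, hx⟩).1 h⟩
  have hl1 : ∀ x ∈ X₁, ∃ y ∈ F1, φ y = h (f x) := fun x hx => hmap1 (hX₁f x hx)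
  have hl3 : ∀ x ∈ X₃, ∃ y ∈ F3, φ y = h (f x) := fun x hx => hmap3 (hX₃f x hx)
  have hl2 : ∀ x ∈ X₂, ∃ y ∈ F2, φ y = h (f x) := fun x hx => by
    have : h (f x) ∈ φ '' F2 := hG2eq ▸ ⟨hmap1 (hX₂f x hx).1, hmap3 (hX₂f x hx).2⟩
    exact this
  have hl12 : ∀ x ∈ X₁ ∩ X₂, ∃ y ∈ F1 ∩ F2, φ y = h (f x) := fun x hx => by
    have hx' : f x ∈ N1 := (h12 hx).2.resolve_left fun hn => hn (hX₁f x hx.1)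
    have : h (f x) ∈ frontier (φ '' F1) := interior_subset (s := h ⁻¹' frontier (φ '' F1)) hx'
    rwa [hfr1] at this
  have hl23 : ∀ x ∈ X₂ ∩ X₃, ∃ y ∈ F2 ∩ F3, φ y = h (f x) := fun x hx => by
    have hx' : f x ∈ N3 := (h23 hx).2.resolve_left fun hn => hn (hX₃f x hx.2)
    have : h (f x) ∈ frontier (φ '' F3) := interior_subset (s := h ⁻¹' frontier (φ '' F3)) hx'
    rwa [hfr3] at this
  let R : Set (X × F) := {p | φ p.2 = h (f p.1)} ∩
    (X₁ ×ˢ F1 ∪ X₂ ×ˢ F2 ∪ X₃ ×ˢ F3)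
  have hR : IsClosed R := (isClosed_eq (hφc.comp continuous_snd)
    (hhc.comp (hf.comp continuous_fst))).inter
    (((hX₁.prod hF1).union (hX₂.prod hF2)).union (hX₃.prod hF3))
  have hex : ∀ x, ∃ y, (x, y) ∈ R := fun x => by
    have hx : x ∈ X₁ ∪ X₂ ∪ X₃ := hcov.symm ▸ mem_univ x
    rcases hx with (hx | hx) | hx
    · obtain ⟨y, hy, hyx⟩ := hl1 x hx
      exact ⟨y, hyx, Or.inl (Or.inl ⟨hx, hy⟩)⟩
    · obtain ⟨y, hy, hyx⟩ := hl2 x hx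
      exact ⟨y, hyx, Or.inl (Or.inr ⟨hx, hy⟩)⟩
    · obtain ⟨y, hy, hyx⟩ := hl3 x hx
      exact ⟨y, hyx, Or.inr ⟨hx, hy⟩⟩
  have huniq12 : ∀ x y z, x ∈ X₁ → y ∈ F1 → x ∈ X₂ → z ∈ F2 → φ y = h (f x) →
      φ z = h (f x) → y = z := by
    intro x y z hx hy hx' hz hyx hzx
    obtain ⟨w, hw, hwx⟩ := hl12 x ⟨hx, hx'⟩
    exact (hi1 hy hw.1 (hyx.trans hwx.symm)).trans (hi2 hw.2 hz (hwx.trans hzx.symm))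
  have huniq23 : ∀ x y z, x ∈ X₂ → y ∈ F2 → x ∈ X₃ → z ∈ F3 → φ y = h (f x) →
      φ z = h (f x) → y = z := by
    intro x y z hx hy hx' hz hyx hzx
    obtain ⟨w, hw, hwx⟩ := hl23 x ⟨hx, hx'⟩
    exact (hi2 hy hw.1 (hyx.trans hwx.symm)).trans (hi3 hw.2 hz (hwx.trans hzx.symm))
  have hno13 : ∀ x, x ∈ X₁ → x ∈ X₃ → False := fun x h1 h3 =>
    eq_empty_iff_forall_notMem.1 h13 x ⟨h1, h3⟩
  have huniq : ∀ x y z, (x, y) ∈ R → (x, z) ∈ R → y = z := by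
    rintro x y z ⟨hyx, (⟨hx, hy⟩ | ⟨hx, hy⟩) | ⟨hx, hy⟩⟩
      ⟨hzx, (⟨hx', hz⟩ | ⟨hx', hz⟩) | ⟨hx', hz⟩⟩
    · exact hi1 hy hz (hyx.trans hzx.symm)
    · exact huniq12 x y z hx hy hx' hz hyx hzx
    · exact (hno13 x hx hx').elim
    · exact (huniq12 x z y hx' hz hx hy hzx hyx).symm
    · exact hi2 hy hz (hyx.trans hzx.symm)
    · exact huniq23 x y z hx hy hx' hz hyx hzx
    · exact (hno13 x hx' hx).elim
    · exact (huniq23 x z y hx' hz hx hy hzx hyx).symm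
    · exact hi3 hy hz (hyx.trans hzx.symm)
  choose g hg using hex
  refine ⟨g, continuous_of_isClosed_setOf_eq ?_, fun x => ?_⟩
  · convert hR using 1
    ext ⟨x, y⟩
    exact ⟨fun hy => (show y = g x from hy) ▸ hg x, fun hy => huniq x y (g x) hy (hg x)⟩
  · rw [(hg x).1, dist_comm]
    exact hhd (f x)

/-- A nontrivial closed interval-like subset of the unit interval is regular. -/
theorem IsRegularSet.of_ordConnected {A : Set unitInterval} (hA : IsClosed A) [A.OrdConnected]
    (hn : A.Nontrivial) : IsRegularSet A := by
  have hcomp : ∀ x ∈ A, connectedComponentIn A x = A := fun x hx =>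
    OrdConnected.isPreconnected ‹_› |>.connectedComponentIn hx
  refine ⟨hA, (finite_singleton A).subset ?_, fun x hx => by rwa [hcomp x hx]⟩
  rintro C ⟨x, hx, rfl⟩
  exact hcomp x hx

/-- The zigzag map of the unit interval, rising to `2 / 3` on `[0, 1 / 3]`, falling to `1 / 3` on
`[1 / 3, 2 / 3]` and rising to `1` on `[2 / 3, 1]`. -/
noncomputable def zigzag (t : unitInterval) : unitInterval :=
  ⟨max (min (2 * t) (1 - t)) (2 * t - 1), by
    have := t.2.1
    have := t.2.2
    exact ⟨le_max_of_le_left (le_min (by linarith) (by linarith)),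
      max_le ((min_le_right _ _).trans (by linarith)) (by linarith)⟩⟩

theorem coe_zigzag (t : unitInterval) :
    (zigzag t : ℝ) = max (min (2 * (t : ℝ)) (1 - t)) (2 * t - 1) := rfl

theorem continuous_zigzag : Continuous zigzag :=
  Continuous.subtype_mk (by fun_prop) _

/-- The zigzag map is a simple fold. -/
theorem isSimpleFold_zigzag {a b : unitInterval} (ha : (a : ℝ) = 1 / 3) (hb : (b : ℝ) = 2 / 3) :
    IsSimpleFold zigzag (Iic a) (Icc a b) (Ici b) := by
  have h1 : ∀ t ≤ a, (zigzag t : ℝ) = 2 * t := fun t ht => by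
    have ht' : (t : ℝ) ≤ a := ht
    rw [coe_zigzag, min_eq_left (by linarith), max_eq_left (by linarith)]
  have h2 : ∀ t ∈ Icc a b, (zigzag t : ℝ) = 1 - t := fun t ht => by
    have ht' : (a : ℝ) ≤ t := ht.1
    have ht'' : (t : ℝ) ≤ b := ht.2
    rw [coe_zigzag, min_eq_right (by linarith), max_eq_left (by linarith)]
  have h3 : ∀ t, b ≤ t → (zigzag t : ℝ) = 2 * t - 1 := fun t ht => by
    have ht' : (b : ℝ) ≤ t := ht
    rw [coe_zigzag, min_eq_right (by linarith), max_eq_right (by linarith)]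
  have hab : a < b := by
    change (a : ℝ) < b
    rw [ha, hb]
    norm_num
  have h0a : 0 < a := by
    change (0 : ℝ) < a
    rw [ha]
    norm_num
  have hb1 : b < 1 := by
    change (b : ℝ) < 1
    rw [hb]
    norm_num
  have hza : zigzag a = b := Subtype.ext (by rw [h1 a le_rfl, ha, hb]; norm_num)
  have hzb : zigzag b = a := Subtype.ext (by rw [h3 b le_rfl, ha, hb]; norm_num)
  have im1 : zigzag '' Iic a = Iic b := by
    ext y
    constructor
    · rintro ⟨t, ht, rfl⟩
      change (zigzag t : ℝ) ≤ b
      have : (t : ℝ) ≤ a := ht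
      rw [h1 t ht]
      linarith
    · intro hy
      have hy' : (y : ℝ) ≤ b := hy
      have hy0 := y.2.1
      have ht : (⟨y / 2, by linarith, by linarith⟩ : unitInterval) ≤ a := by
        change (y / 2 : ℝ) ≤ a
        linarith
      refine ⟨_, ht, Subtype.ext ?_⟩
      rw [h1 _ ht]
      ring
  have im2 : zigzag '' Icc a b = Icc a b := by
    ext y
    constructor
    · rintro ⟨t, ht, rfl⟩
      have ht' : (a : ℝ) ≤ t := ht.1
      have ht'' : (t : ℝ) ≤ b := ht.2
      constructor
      · change (a : ℝ) ≤ zigzag t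
        rw [h2 t ht]
        linarith
      · change (zigzag t : ℝ) ≤ b
        rw [h2 t ht]
        linarith
    · rintro ⟨hya, hyb⟩
      have hya' : (a : ℝ) ≤ y := hya
      have hyb' : (y : ℝ) ≤ b := hyb
      have ht : (⟨1 - y, by linarith, by linarith⟩ : unitInterval) ∈ Icc a b := by
        constructor
        · change (a : ℝ) ≤ 1 - y
          linarith
        · change (1 - y : ℝ) ≤ b
          linarith
      refine ⟨_, ht, Subtype.ext ?_⟩
      rw [h2 _ ht]
      ring
  have im3 : zigzag '' Ici b = Ici a := by
    ext y
    constructor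
    · rintro ⟨t, ht, rfl⟩
      change (a : ℝ) ≤ zigzag t
      have : (b : ℝ) ≤ t := ht
      rw [h3 t ht]
      linarith
    · intro hy
      have hy' : (a : ℝ) ≤ y := hy
      have hy1 := y.2.2
      have ht : b ≤ (⟨(1 + y) / 2, by linarith, by linarith⟩ : unitInterval) := by
        change (b : ℝ) ≤ (1 + y) / 2
        linarith
      refine ⟨_, ht, Subtype.ext ?_⟩
      rw [h3 _ ht]
      ring
  have emb : ∀ E : Set unitInterval, IsClosed E → InjOn zigzag E →
      MapsHomeoOnto zigzag E (zigzag '' E) := by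
    intro E hE hi
    have : CompactSpace E := isCompact_iff_compactSpace.1 hE.isCompact
    exact ⟨rfl, ((continuous_zigzag.comp continuous_subtype_val).isClosedEmbedding
      (injOn_iff_injective.1 hi)).isEmbedding⟩
  refine ⟨continuous_zigzag, ?_, ⟨?_, ?_, ?_⟩, ⟨?_, ?_, ?_⟩, ?_, ?_, ?_, ⟨?_, ?_, ?_⟩, ?_, ?_, ?_⟩
  · rw [Iic_union_Icc_eq_Iic hab.le, Iic_union_Ici]
  · exact nonempty_Iic.image _
  · exact (nonempty_Icc.2 hab.le).image _
  · exact nonempty_Ici.image _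
  · rw [im1]
    exact .of_ordConnected isClosed_Iic ⟨a, hab.le, b, self_mem_Iic, hab.ne⟩
  · rw [im2]
    exact .of_ordConnected isClosed_Icc ⟨a, ⟨le_rfl, hab.le⟩, b, ⟨hab.le, le_rfl⟩, hab.ne⟩
  · rw [im3]
    exact .of_ordConnected isClosed_Ici ⟨a, self_mem_Ici, b, hab.le, hab.ne⟩
  · rw [im1, im3]
    exact eq_univ_of_forall fun y => (le_total y b).imp id fun h => hab.le.trans h
  · rw [im1, im2, im3, inter_comm, Ici_inter_Iic]
  · rw [im1, im2, im3]
    have hl : closure (Iic b \ Icc a b) ⊆ Iic a := closure_minimal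
      (fun y hy => le_of_not_ge fun h => hy.2 ⟨h, hy.1⟩) isClosed_Iic
    have hr : closure (Ici a \ Icc a b) ⊆ Ici b := closure_minimal
      (fun y hy => le_of_not_ge fun h => hy.2 ⟨hy.1, h⟩) isClosed_Ici
    exact eq_empty_of_forall_notMem fun y hy => absurd ((hr hy.2).trans (hl hy.1)) hab.not_ge
  · refine emb _ isClosed_Iic fun s hs t ht hst => Subtype.ext ?_
    have := congrArg Subtype.val hst
    rw [h1 s hs, h1 t ht] at this
    linarith
  · refine emb _ isClosed_Icc fun s hs t ht hst => Subtype.ext ?_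
    have := congrArg Subtype.val hst
    rw [h2 s hs, h2 t ht] at this
    linarith
  · refine emb _ isClosed_Ici fun s hs t ht hst => Subtype.ext ?_
    have := congrArg Subtype.val hst
    rw [h3 s hs, h3 t ht] at this
    linarith
  · have : Iic a ∩ Icc a b = {a} := by
      ext t
      exact ⟨fun h => le_antisymm h.1 h.2.1, by rintro rfl; exact ⟨self_mem_Iic, le_rfl, hab.le⟩⟩
    rw [im1, frontier_Iic' (a := b) ⟨1, hb1⟩, this, image_singleton, hza]
  · have : Icc a b ∩ Ici b = {b} := by
      ext t
      exact ⟨fun h => le_antisymm h.1.2 h.2, by rintro rfl; exact ⟨⟨hab.le, le_rfl⟩, self_mem_Ici⟩⟩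
    rw [im3, frontier_Ici' (a := a) ⟨0, h0a⟩, this, image_singleton, hzb]
  · exact eq_empty_of_forall_notMem fun y hy => absurd (hy.2.trans hy.1) hab.not_ge

/-- A union of two closed sets, neither containing the other, carries a map to the unit interval
that is at most `1 / 2` on one set, at least `1 / 2` on the other, and attains `0` and `1`. -/
theorem exists_continuous_le_half_ge_half {X : Type*} [TopologicalSpace X] [NormalSpace X]
    [T1Space X] {A B : Set X} (hA : IsClosed A) (hB : IsClosed B) {a b : X} (ha : a ∉ B)
    (hb : b ∉ A) : ∃ f : X → unitInterval, Continuous f ∧ (a ∈ A → f a = 0) ∧ (b ∈ B → f b = 1) ∧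
      (∀ x ∈ A, (f x : ℝ) ≤ 1 / 2) ∧ ∀ x ∈ B, 1 / 2 ≤ (f x : ℝ) := by
  obtain ⟨p, hp0, hp1, hp⟩ := exists_continuous_zero_one_of_isClosed (isClosed_singleton (x := a))
    hB (disjoint_singleton_left.2 ha)
  obtain ⟨q, hq0, hq1, hq⟩ := exists_continuous_zero_one_of_isClosed hA
    (isClosed_singleton (x := b)) (disjoint_singleton_right.2 hb)
  refine ⟨fun x => ⟨(p x + q x) / 2, ?_, ?_⟩, ?_, fun h => Subtype.ext ?_,
    fun h => Subtype.ext ?_, fun x hx => ?_, fun x hx => ?_⟩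
  · linarith [(hp x).1, (hq x).1]
  · linarith [(hp x).2, (hq x).2]
  · exact Continuous.subtype_mk (by fun_prop) _
  · simp [hp0 (mem_singleton a), hq0 h]
  · simp [hp1 h, hq1 (mem_singleton b)]
  · have h0 : q x = 0 := hq0 hx
    change (p x + q x) / 2 ≤ 1 / 2
    linarith [(hp x).2]
  · have h1 : p x = 1 := hp1 hx
    change 1 / 2 ≤ (p x + q x) / 2
    linarith [(hq x).1]

/-- If maps to the unit interval lift approximately through the zigzag map, the space is
hereditarily indecomposable. -/
theorem HereditarilyIndecomposable.of_exists_lift_zigzag {X : Type*} [TopologicalSpace X]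
    [NormalSpace X] [T2Space X]
    (h : ∀ f : X → unitInterval, Continuous f → ∃ g : X → unitInterval, Continuous g ∧
      ∀ x, dist (f x) (zigzag (g x)) < 1 / 12) : HereditarilyIndecomposable X := by
  rintro K - hK - ⟨A, B, hAc, hAn, hBc, hBn, rfl, hAK, hBK⟩
  obtain ⟨b, hbB, hbA⟩ : ∃ b ∈ B, b ∉ A := not_subset.1 fun h => hAK (union_eq_left.2 h).symm
  obtain ⟨a, haA, haB⟩ : ∃ a ∈ A, a ∉ B := not_subset.1 fun h => hBK (union_eq_right.2 h).symm
  obtain ⟨c, hcA, hcB⟩ : (A ∩ B).Nonempty := by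
    obtain ⟨c, -, hc⟩ := isPreconnected_closed_iff.1 hK.isPreconnected A B hAc.isClosed
      hBc.isClosed Subset.rfl ⟨a, Or.inl haA, haA⟩ ⟨b, Or.inr hbB, hbB⟩
    exact ⟨c, hc⟩
  obtain ⟨f, hf, hfa, hfb, hfA, hfB⟩ :=
    exists_continuous_le_half_ge_half hAc.isClosed hBc.isClosed haB hbA
  obtain ⟨g, hg, hgf⟩ := h f hf
  replace hgf : ∀ x, |(f x : ℝ) - max (min (2 * (g x : ℝ)) (1 - g x)) (2 * g x - 1)| < 1 / 12 :=
    hgf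
  have hgc : Continuous fun x => (g x : ℝ) := continuous_subtype_val.comp hg
  have hcA' : (g c : ℝ) < 1 / 3 := by
    by_contra hge
    have ha0 : (f a : ℝ) = 0 := by rw [hfa haA]; rfl
    have hga := hgf a
    have : (g a : ℝ) ≤ 1 / 3 := by rw [abs_lt] at hga; grind
    obtain ⟨x, hx, hxe⟩ := hAn.isPreconnected.intermediate_value haA hcA hgc.continuousOn
      ⟨this, not_lt.1 hge⟩
    have h1 := hgf x
    have h2 := hfA x hx
    simp only at hxe
    rw [hxe, abs_lt] at h1
    norm_num at h1
    linarith
  have hcB' : 2 / 3 < (g c : ℝ) := by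
    by_contra hge
    have hb1 : (f b : ℝ) = 1 := by rw [hfb hbB]; rfl
    have hgb := hgf b
    have : 2 / 3 ≤ (g b : ℝ) := by rw [abs_lt] at hgb; grind
    obtain ⟨x, hx, hxe⟩ := hBn.isPreconnected.intermediate_value hcB hbB hgc.continuousOn
      ⟨not_lt.1 hge, this⟩
    have h1 := hgf x
    have h2 := hfB x hx
    simp only at hxe
    rw [hxe, abs_lt] at h1
    norm_num at h1
    linarith
  linarith

/-- characterization of hereditary indecomposability via simple folds over [0,1]. -/
theorem stmt9 (X : Type*) [MetricSpace X] [CompactSpace X] :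
    HereditarilyIndecomposable X ↔
    ∀ f : X → unitInterval, Continuous f →
      ∀ (F : Type) [TopologicalSpace F], Nonempty (F ≃ₜ unitInterval) →
      ∀ (φ : F → unitInterval) (F1 F2 F3 : Set F), IsSimpleFold φ F1 F2 F3 →
      ∀ ε > (0 : ℝ), ∃ g : X → F, Continuous g ∧ ∀ x, dist (f x) (φ (g x)) < ε := by
  constructor
  · rintro hX f hf F _ ⟨e⟩ φ F1 F2 F3 hφ ε hε
    have := e.symm.compactSpace
    have := e.symm.t2Space
    exact hX.exists_lift hf hφ hε
  · intro h
    refine .of_exists_lift_zigzag fun f hf => ?_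
    exact h f hf unitInterval ⟨.refl _⟩ zigzag _ _ _
      (isSimpleFold_zigzag (a := ⟨1 / 3, by norm_num, by norm_num⟩)
        (b := ⟨2 / 3, by norm_num, by norm_num⟩) rfl rfl) (1 / 12) (by norm_num)
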